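/- Let a, b be natural numbers with b > a ≥ 1, set q = b/a and P(x₁,x₂) = x₁^a − x₂^b, let ε > 0 and 0 < ρ, δ < ε. Let κ : [0,ρ] → ℝ², κ(t) = (t·ρ^{q−1}, t); let γ : [ρ,ε] → ℝ², γ(t) = (t^q, t); and let σ : [0, 2(ε+ε^q)δ] → ℝ² be the clockwise parameterization of the boundary of the rectangle E_δ = [ε^q, ε^q(1+δ)] × [ε(1−δ), ε] starting at (ε^q, ε), given piecewise by σ(t) = (ε^q + t, ε) for t ∈ [0, ε^qδ], σ(t) = (ε^q(1+δ), ε + ε^qδ − t) for t ∈ [ε^qδ, (ε+ε^q)δ], σ(t) = (ε^q + (ε+2ε^q)δ − t, ε(1−δ)) for t ∈ [(ε+ε^q)δ, (ε+2ε^q)δ], and σ(t) = (ε^q, ε − 2(ε+ε^q)δ + t) for t ∈ [(ε+2ε^q)δ, 2(ε+ε^q)δ]. Then ∫₀^ρ κ₂'(t)·P(κ(t))² dt + ∫_ρ^ε γ₂'(t)·P(γ(t))² dt + ∫₀^{2(ε+ε^q)δ} σ₂'(t)·P(σ(t))² dt = ρ^{2b+1}·∫₀¹ (s^a − s^b)²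 ds − ∫_{ε(1−δ)}^{ε} ∫_{ε^q}^{ε^q(1+δ)} 2a·x₁^{a−1}·(x₁^a − x₂^b) dx₁ dx₂. -/

import Mathlib

open MeasureTheory Set

/-- The clockwise parameterization of the boundary of the rectangle
`E_δ = [ε^q, ε^q(1+δ)] × [ε(1−δ), ε]`, starting at `(ε^q, ε)`, defined for
`t ∈ [0, 2(ε+ε^q)δ]`. -/
noncomputable def sigmaCurve (q ε δ : ℝ) (t : ℝ) : ℝ × ℝ :=
  if t ≤ ε ^ q * δ then (ε ^ q + t, ε)
  else if t ≤ (ε + ε ^ q) * δ then (ε ^ q * (1 + δ), ε + ε ^ q * δ - t)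
  else if t ≤ (ε + 2 * ε ^ q) * δ then (ε ^ q + (ε + 2 * ε ^ q) * δ - t, ε * (1 - δ))
  else (ε ^ q, ε - 2 * (ε + ε ^ q) * δ + t)

/-- The (a.e.) derivative of the second component of `sigmaCurve`. -/
noncomputable def dsigmaCurve2 (q ε δ : ℝ) (t : ℝ) : ℝ :=
  if t ≤ ε ^ q * δ then 0
  else if t ≤ (ε + ε ^ q) * δ then -1
  else if t ≤ (ε + 2 * ε ^ q) * δ then 0
  else 1

theorem intervalIntegral_eq_of_eqOn_Ioc {f g : ℝ → ℝ} {u v : ℝ} (huv : u ≤ v)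
    (hg : Continuous g) (h : EqOn g f (Ioc u v)) :
    IntervalIntegrable f volume u v ∧ ∫ t in u..v, f t = ∫ t in u..v, g t := by
  rw [← uIoc_of_le huv] at h
  refine ⟨(hg.intervalIntegrable u v).congr h, ?_⟩
  exact intervalIntegral.integral_congr_ae (Filter.Eventually.of_forall fun t ht => (h ht).symm)

/-- The integral of `ω₂' · F(ω)` along the clockwise boundary of the rectangle only sees its two
vertical sides. -/
theorem integral_sigmaCurve {F : ℝ × ℝ → ℝ} (hF : Continuous F) {q ε δ : ℝ}
    (hε : 0 < ε) (hδ : 0 < δ) :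
    ∫ t in (0:ℝ)..(2 * (ε + ε ^ q) * δ), dsigmaCurve2 q ε δ t * F (sigmaCurve q ε δ t)
      = (∫ y in (ε * (1 - δ))..ε, F (ε ^ q, y))
        - ∫ y in (ε * (1 - δ))..ε, F (ε ^ q * (1 + δ), y) := by
  have hA : 0 < ε ^ q := Real.rpow_pos_of_pos hε q
  have hAδ : 0 < ε ^ q * δ := mul_pos hA hδ
  have hεδ : 0 < ε * δ := mul_pos hε hδ
  simp only [dsigmaCurve2, sigmaCurve]
  generalize ε ^ q = A at *
  set f : ℝ → ℝ := fun t =>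
    (if t ≤ A * δ then 0 else if t ≤ (ε + A) * δ then -1
      else if t ≤ (ε + 2 * A) * δ then 0 else 1) *
    F (if t ≤ A * δ then (A + t, ε)
      else if t ≤ (ε + A) * δ then (A * (1 + δ), ε + A * δ - t)
      else if t ≤ (ε + 2 * A) * δ then (A + (ε + 2 * A) * δ - t, ε * (1 - δ))
      else (A, ε - 2 * (ε + A) * δ + t)) with hf
  obtain ⟨i₁, e₁⟩ := intervalIntegral_eq_of_eqOn_Ioc (f := f) (g := fun _ => 0)
    (u := 0) (v := A * δ) hAδ.le continuous_const (fun t ht => by simp [hf, ht.2])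
  obtain ⟨i₂, e₂⟩ := intervalIntegral_eq_of_eqOn_Ioc (f := f)
    (g := fun t => -F (A * (1 + δ), ε + A * δ - t))
    (u := A * δ) (v := (ε + A) * δ) (by linarith) (by fun_prop)
    (fun t ht => by simp [hf, ht.2, not_le.mpr ht.1])
  obtain ⟨i₃, e₃⟩ := intervalIntegral_eq_of_eqOn_Ioc (f := f) (g := fun _ => 0)
    (u := (ε + A) * δ) (v := (ε + 2 * A) * δ) (by linarith) continuous_const
    (fun t ht => by
      have h₁ : ¬ t ≤ A * δ := by linarith [ht.1]
      simp [hf, ht.2, h₁, not_le.mpr ht.1])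
  obtain ⟨i₄, e₄⟩ := intervalIntegral_eq_of_eqOn_Ioc (f := f)
    (g := fun t => F (A, ε - 2 * (ε + A) * δ + t))
    (u := (ε + 2 * A) * δ) (v := 2 * (ε + A) * δ) (by linarith) (by fun_prop)
    (fun t ht => by
      have h₁ : ¬ t ≤ A * δ := by linarith [ht.1]
      have h₂ : ¬ t ≤ (ε + A) * δ := by linarith [ht.1]
      simp [hf, h₁, h₂, not_le.mpr ht.1])
  rw [← intervalIntegral.integral_add_adjacent_intervals ((i₁.trans i₂).trans i₃) i₄,
    ← intervalIntegral.integral_add_adjacent_intervals (i₁.trans i₂) i₃,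
    ← intervalIntegral.integral_add_adjacent_intervals i₁ i₂, e₁, e₂, e₃, e₄,
    intervalIntegral.integral_neg,
    intervalIntegral.integral_comp_sub_left (fun y => F (A * (1 + δ), y)),
    intervalIntegral.integral_comp_add_left (fun y => F (A, y))]
  have h₁ : ε + A * δ - (ε + A) * δ = ε * (1 - δ) := by ring
  have h₂ : ε + A * δ - A * δ = ε := by ring
  have h₃ : ε - 2 * (ε + A) * δ + (ε + 2 * A) * δ = ε * (1 - δ) := by ring
  have h₄ : ε - 2 * (ε + A) * δ + 2 * (ε + A) * δ = ε := by ring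
  rw [h₁, h₂, h₃, h₄, intervalIntegral.integral_zero, intervalIntegral.integral_zero]
  ring

theorem integral_deriv_sq_pow_sub (a : ℕ) (c u v : ℝ) :
    ∫ x in u..v, 2 * a * x ^ (a - 1) * (x ^ a - c) = (v ^ a - c) ^ 2 - (u ^ a - c) ^ 2 := by
  refine intervalIntegral.integral_eq_sub_of_hasDerivAt (f := fun x => (x ^ a - c) ^ 2)
    (fun x _ => ?_) (Continuous.intervalIntegrable (by fun_prop) _ _)
  refine (((hasDerivAt_pow a x).sub_const c).fun_pow 2).congr_deriv ?_
  push_cast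
  ring

theorem rpow_div_pow_eq_pow {a b : ℕ} (ha : 1 ≤ a) {t : ℝ} (ht : 0 ≤ t) :
    (t ^ ((b : ℝ) / a)) ^ a = t ^ b := by
  have ha' : (a : ℝ) ≠ 0 := by positivity
  rw [← Real.rpow_natCast, ← Real.rpow_mul ht, div_mul_cancel₀ _ ha', Real.rpow_natCast]

theorem integral_sq_cut {a b : ℕ} (ha : 1 ≤ a) {ρ : ℝ} (hρ : 0 < ρ) :
    ∫ t in (0:ℝ)..ρ, ((t * ρ ^ ((b : ℝ) / a - 1)) ^ a - t ^ b) ^ 2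
      = ρ ^ (2 * b + 1) * ∫ s in (0:ℝ)..1, (s ^ a - s ^ b) ^ 2 := by
  have h := intervalIntegral.smul_integral_comp_mul_left (a := 0) (b := 1)
    (fun t : ℝ => ((t * ρ ^ ((b : ℝ) / a - 1)) ^ a - t ^ b) ^ 2) ρ
  rw [mul_zero, mul_one] at h
  rw [← h, pow_succ', mul_assoc, smul_eq_mul, ← intervalIntegral.integral_const_mul (ρ ^ (2 * b))]
  congr 2
  funext s
  have hs : ρ * s * ρ ^ ((b : ℝ) / a - 1) = s * ρ ^ ((b : ℝ) / a) := by
    rw [Real.rpow_sub_one hρ.ne']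
    field_simp
  rw [hs, mul_pow, rpow_div_pow_eq_pow ha hρ.le]
  ring

/-- The third coordinate acquired by the horizontal lift of the competing curve
`ω_{ρ,δ} = κ_ρ * γ|_{[ρ,ε]} * σ_δ` equals the cut contribution `ρ^{2b+1}∫₀¹(s^a−s^b)² ds` minus
the weighted area of the rectangle `E_δ` (an instance of Green's theorem). Here
`κ_ρ(t) = (t·ρ^{q−1}, t)`, `γ(t) = (t^q, t)`, and `σ_δ` is the clockwise boundary of `E_δ`. -/
theorem third_coordinate_of_competitor (a b : ℕ) (ha : 1 ≤ a) (hab : a < b)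
    (q : ℝ) (hq : q = (b : ℝ) / a) (ε ρ δ : ℝ) (hε : 0 < ε)
    (hρ : 0 < ρ) (hρε : ρ < ε) (hδ : 0 < δ) (hδε : δ < ε) :
    (∫ t in (0:ℝ)..ρ, 1 * ((t * ρ ^ (q - 1)) ^ a - t ^ b) ^ 2)
      + (∫ t in ρ..ε, 1 * ((t ^ q) ^ a - t ^ b) ^ 2)
      + (∫ t in (0:ℝ)..(2 * (ε + ε ^ q) * δ),
          dsigmaCurve2 q ε δ t *
            ((sigmaCurve q ε δ t).1 ^ a - (sigmaCurve q ε δ t).2 ^ b) ^ 2)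
    = ρ ^ (2 * b + 1) * (∫ s in (0:ℝ)..1, (s ^ a - s ^ b) ^ 2)
      - ∫ x2 in (ε * (1 - δ))..ε, ∫ x1 in (ε ^ q)..(ε ^ q * (1 + δ)),
          2 * a * x1 ^ (a - 1) * (x1 ^ a - x2 ^ b) := by
  subst hq
  simp only [one_mul]
  have hγ : ∫ t in ρ..ε, ((t ^ ((b : ℝ) / a)) ^ a - t ^ b) ^ 2 = 0 := by
    refine (intervalIntegral.integral_congr (g := fun _ => 0) fun t ht => ?_).trans (by simp)
    rw [uIcc_of_le hρε.le] at ht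
    simp [rpow_div_pow_eq_pow ha (hρ.le.trans ht.1)]
  have hσ := integral_sigmaCurve (F := fun p => (p.1 ^ a - p.2 ^ b) ^ 2) (by fun_prop)
    (q := (b : ℝ) / a) hε hδ
  simp only [integral_deriv_sq_pow_sub]
  rw [integral_sq_cut ha hρ, hγ, hσ, intervalIntegral.integral_sub
    (Continuous.intervalIntegrable (by fun_prop) _ _)
    (Continuous.intervalIntegrable (by fun_prop) _ _)]
  ring
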